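/- arXiv:1906.05823 — 8 statements merged into one kernel-verified Lean document; each statement's English description precedes it below -/
import Mathlib

section
/- The linear map α: T(𝔄) → T(𝔄) defined by α(e) = e and α(w₁⋯wₙ) = (−1)ⁿ Σ_{I∈C(n)} I[wₙ⋯w₁] is an antipode for the quasi-shuffle bialgebra, i.e., m_⋆(α ⊗ id)δ = ηε = m_⋆(id ⊗ α)δ, so that (T(𝔄), ⋆, δ, ε, α) is a Hopf algebra. -/
noncomputable section

open scoped BigOperators

namespace TimeWarp

/-- The free commutative semigroup `𝔄` on the alphabet `A = {1,…,d}` (modelled as `Fin d`):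
its elements are the nonempty finite multisets of letters, multiplied by union. -/
abbrev Bracket (d : ℕ) := {m : Multiset (Fin d) // m ≠ 0}

instance {d : ℕ} : Mul (Bracket d) :=
  ⟨fun a b => ⟨a.1 + b.1, fun h => a.2 (by
    have hc := Multiset.card_add a.1 b.1
    rw [h] at hc
    simp at hc
    exact Multiset.card_eq_zero.mp (by omega))⟩⟩

/-- Words with letters in the semigroup `𝔄`; the basis of the tensor algebra `T(𝔄)`. -/
abbrev Word (d : ℕ) := List (Bracket d)

/-- The tensor algebra `T(𝔄)`, as the free vector space on words. -/
abbrev TA (K : Type*) [Field K] (d : ℕ) := Word d →₀ K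

/-- The weight grading: each bracket has weight the number of letters in it. -/
def wordWeight {d : ℕ} (w : Word d) : ℕ := (w.map fun a => Multiset.card a.1).sum

variable {K : Type*} [Field K] {d : ℕ}
/-- Quasi-shuffle product on (reversed) words: the head of the list is the *last* letter
of the word.  `qshRev (u ++ [a]).reverse (v ++ [b]).reverse` encodes
`ua ⋆ vb = (u ⋆ vb)a + (ua ⋆ v)b + (u ⋆ v)[ab]`. -/
def qshRev : Word d → Word d → TA K d
  | [], v => Finsupp.single v 1
  | u, [] => Finsupp.single u 1
  | a :: u, b :: v =>
      Finsupp.mapDomain (a :: ·) (qshRev u (b :: v)) +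
      Finsupp.mapDomain (b :: ·) (qshRev (a :: u) v) +
      Finsupp.mapDomain ((a * b) :: ·) (qshRev u v)
termination_by u v => u.length + v.length
decreasing_by all_goals (simp only [List.length_cons]; omega)

/-- The quasi-shuffle product `u ⋆ v` of two words, an element of `T(𝔄)`. -/
def qshW (u v : Word d) : TA K d :=
  Finsupp.mapDomain List.reverse (qshRev u.reverse v.reverse)

/-- The bilinear extension of the quasi-shuffle product to all of `T(𝔄)`. -/
def qshL (f g : TA K d) : TA K d :=
  f.sum fun u cu => g.sum fun v cv => (cu * cv) • qshW u v
/-- Product (in the semigroup `𝔄`) of the letters of a nonempty block. -/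
def blockProd : Word d → Option (Bracket d)
  | [] => none
  | a :: t => some (t.foldl (· * ·) a)

/-- `I[w]`: contract the word `w` along the composition `I`, multiplying the letters
inside each block in the semigroup `𝔄`. -/
def Iword {n : ℕ} (c : Composition n) (w : Word d) : Word d :=
  (w.splitWrtComposition c).filterMap blockProd

/-- The antipode candidate `α(w₁⋯wₙ) = (−1)ⁿ Σ_{I ∈ C(n)} I[wₙ⋯w₁]`. -/
def alphaW (w : Word d) : TA K d :=
  ((-1 : K) ^ w.length) •
    ∑ c : Composition w.length, Finsupp.single (Iword c w.reverse) (1 : K)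

instance {d : ℕ} : CommSemigroup (Bracket d) where
  mul_assoc a b c := Subtype.ext (add_assoc a.1 b.1 c.1)
  mul_comm a b := Subtype.ext (add_comm a.1 b.1)

section Operators

variable (K : Type*) [Field K] {d : ℕ}

/-- The linear map prepending a letter to every word. -/
def consL (a : Bracket d) : TA K d →ₗ[K] TA K d := Finsupp.lmapDomain K K (a :: ·)

/-- The linear map appending a letter to every word. -/
def snocL (a : Bracket d) : TA K d →ₗ[K] TA K d := Finsupp.lmapDomain K K (· ++ [a])

/-- The linear map reversing every word. -/
def revL : TA K d →ₗ[K] TA K d := Finsupp.lmapDomain K K List.reverse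

/-- Left quasi-shuffle multiplication by a (reversed) word. -/
def qshLeft (u : Word d) : TA K d →ₗ[K] TA K d := Finsupp.linearCombination K (qshRev u)

@[simp] lemma consL_single (a : Bracket d) (u : Word d) (r : K) :
    consL K a (Finsupp.single u r) = Finsupp.single (a :: u) r := by
  simp [consL]

@[simp] lemma snocL_single (a : Bracket d) (u : Word d) (r : K) :
    snocL K a (Finsupp.single u r) = Finsupp.single (u ++ [a]) r := by
  simp [snocL]

@[simp] lemma revL_single (u : Word d) (r : K) :
    revL K (Finsupp.single u r) = Finsupp.single u.reverse r := by
  simp [revL]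

@[simp] lemma qshLeft_single (u v : Word d) :
    qshLeft K u (Finsupp.single v 1) = qshRev u v := by
  simp [qshLeft]

lemma consL_snocL (a b : Bracket d) (f : TA K d) :
    consL K a (snocL K b f) = snocL K b (consL K a f) := by
  induction f using Finsupp.induction_linear with
  | zero => simp
  | add f g hf hg => simp [hf, hg]
  | single u r => simp

lemma revL_snocL (a : Bracket d) (f : TA K d) :
    revL K (snocL K a f) = consL K a (revL K f) := by
  induction f using Finsupp.induction_linear with
  | zero => simp
  | add f g hf hg => simp [hf, hg]
  | single u r => simp

lemma revL_consL (a : Bracket d) (f : TA K d) :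
    revL K (consL K a f) = snocL K a (revL K f) := by
  induction f using Finsupp.induction_linear with
  | zero => simp
  | add f g hf hg => simp [hf, hg]
  | single u r => simp

lemma revL_revL (f : TA K d) : revL K (revL K f) = f := by
  induction f using Finsupp.induction_linear with
  | zero => simp
  | add f g hf hg => simp [hf, hg]
  | single u r => simp

end Operators

section QuasiShuffle

variable {K : Type*} [Field K] {d : ℕ}

@[simp] lemma qshRev_nil_left (v : Word d) :
    (qshRev [] v : TA K d) = Finsupp.single v 1 := by
  simp [qshRev]

@[simp] lemma qshRev_nil_right (u : Word d) :
    (qshRev u [] : TA K d) = Finsupp.single u 1 := by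
  cases u <;> simp [qshRev]

lemma qshRev_cons_cons (a b : Bracket d) (u v : Word d) :
    (qshRev (a :: u) (b :: v) : TA K d) =
      consL K a (qshRev u (b :: v)) + consL K b (qshRev (a :: u) v) +
        consL K (a * b) (qshRev u v) := by
  rw [qshRev]; rfl

lemma qshRev_comm (u v : Word d) : (qshRev u v : TA K d) = qshRev v u := by
  induction u generalizing v with
  | nil => simp
  | cons a u ihu =>
    induction v with
    | nil => simp
    | cons b v ihv =>
      rw [qshRev_cons_cons, qshRev_cons_cons, ihv, ihu, ihu, mul_comm a b]
      abel

lemma qshRev_concat_concat (a b : Bracket d) (u v : Word d) :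
    (qshRev (u ++ [a]) (v ++ [b]) : TA K d) =
      snocL K a (qshRev u (v ++ [b])) + snocL K b (qshRev (u ++ [a]) v) +
        snocL K (a * b) (qshRev u v) := by
  induction u generalizing v with
  | nil =>
    induction v with
    | nil =>
      simp [qshRev_cons_cons]
      abel
    | cons c v ihv =>
      simp only [List.nil_append, List.cons_append, qshRev_nil_left] at ihv ⊢
      simp only [qshRev_cons_cons, ihv, map_add, consL_snocL, qshRev_nil_left, consL_single,
        snocL_single, List.cons_append]
      abel
  | cons e u ihu =>
    induction v with
    | nil =>
      have h := ihu []
      simp only [List.nil_append, List.cons_append, qshRev_nil_right] at h ⊢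
      simp only [qshRev_cons_cons, h, map_add, consL_snocL, qshRev_nil_right, consL_single,
        snocL_single, List.cons_append]
      abel
    | cons c v ihv =>
      have h₁ := ihu (c :: v)
      have h₂ := ihu v
      simp only [List.cons_append] at ihv h₁ ⊢
      simp only [qshRev_cons_cons, ihv, h₁, h₂, map_add, consL_snocL]
      abel

lemma qshRev_reverse_reverse (u v : Word d) :
    (qshRev u.reverse v.reverse : TA K d) = revL K (qshRev u v) := by
  induction u generalizing v with
  | nil => simp
  | cons a u ihu =>
    induction v with
    | nil => simp
    | cons b v ihv =>
      have h := ihu (b :: v)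
      simp only [List.reverse_cons] at ihv h ⊢
      rw [qshRev_concat_concat, ihv, h, ihu, qshRev_cons_cons]
      simp only [map_add, revL_consL]

lemma qshW_eq_qshRev (u v : Word d) : (qshW u v : TA K d) = qshRev u v := by
  change revL K (qshRev u.reverse v.reverse) = _
  rw [qshRev_reverse_reverse, revL_revL]

lemma qshL_single_left (u : Word d) (g : TA K d) :
    qshL (Finsupp.single u 1) g = qshLeft K u g := by
  simp [qshL, qshLeft, Finsupp.linearCombination_apply, qshW_eq_qshRev]

lemma qshL_single_right (u : Word d) (g : TA K d) :
    qshL g (Finsupp.single u 1) = qshLeft K u g := by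
  simp [qshL, qshLeft, Finsupp.linearCombination_apply, qshW_eq_qshRev, qshRev_comm u]

lemma qshLeft_nil (g : TA K d) : qshLeft K [] g = g := by
  induction g using Finsupp.induction_linear with
  | zero => simp
  | add f g hf hg => simp [hf, hg]
  | single u r => simp [qshLeft]

lemma qshLeft_cons_consL (a b : Bracket d) (u : Word d) (g : TA K d) :
    qshLeft K (a :: u) (consL K b g) =
      consL K a (qshLeft K u (consL K b g)) + consL K b (qshLeft K (a :: u) g) +
        consL K (a * b) (qshLeft K u g) := by
  induction g using Finsupp.induction_linear with
  | zero => simp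
  | add f g hf hg =>
    simp only [map_add, hf, hg]
    abel
  | single v r => simp [qshLeft, qshRev_cons_cons]

lemma qshLeft_reverse (u : Word d) (g : TA K d) :
    qshLeft K u.reverse (revL K g) = revL K (qshLeft K u g) := by
  induction g using Finsupp.induction_linear with
  | zero => simp
  | add f g hf hg => simp [hf, hg]
  | single v r => simp [qshLeft, qshRev_reverse_reverse]

end QuasiShuffle

section Contractions

variable (K : Type*) [Field K] {d : ℕ}

/-- The sum of all contractions of the nonempty word `a :: t`. -/
def contractCons : Bracket d → Word d → TA K d
  | a, [] => Finsupp.single [a] 1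
  | a, b :: t => consL K a (contractCons b t) + contractCons (a * b) t

/-- The sum of all contractions of a word. -/
def contract : Word d → TA K d
  | [] => Finsupp.single [] 1
  | a :: t => contractCons K a t

lemma contract_cons (a : Bracket d) (t : Word d) :
    contract K (a :: t) = contractCons K a t := rfl

lemma contractCons_concat_concat (a x y : Bracket d) (l : Word d) :
    contractCons K a (l ++ [x, y]) =
      snocL K y (contractCons K a (l ++ [x])) + contractCons K a (l ++ [x * y]) := by
  induction l generalizing a with
  | nil =>
    simp [contractCons, mul_assoc]
    abel
  | cons b l ih =>
    simp only [List.cons_append, contractCons, ih, map_add, consL_snocL]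
    abel

lemma contract_concat_concat (x y : Bracket d) (l : Word d) :
    contract K (l ++ [x, y]) =
      snocL K y (contract K (l ++ [x])) + contract K (l ++ [x * y]) := by
  cases l with
  | nil => simp [contract, contractCons]
  | cons a l => exact contractCons_concat_concat K a x y l

lemma contract_reverse (w : Word d) : contract K w.reverse = revL K (contract K w) := by
  cases w with
  | nil => simp [contract]
  | cons a t =>
    induction t generalizing a with
    | nil => simp [contract, contractCons]
    | cons b t ih =>
      have h₁ := ih b
      have h₂ := ih (a * b)
      simp only [List.reverse_cons, contract_cons] at h₁ h₂
      simp only [List.reverse_cons, List.append_assoc, List.singleton_append, contract_cons,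
        contractCons, contract_concat_concat, mul_comm b a, h₁, h₂, map_add, revL_consL]

/-- The contraction of a word along a list of block lengths. -/
def contractAlong (ns : List ℕ) (w : Word d) : Word d :=
  (w.splitWrtCompositionAux ns).filterMap blockProd

lemma contractAlong_one_cons (ns : List ℕ) (a : Bracket d) (t : Word d) :
    contractAlong (1 :: ns) (a :: t) = a :: contractAlong ns t := by
  simp [contractAlong, List.splitWrtCompositionAux, blockProd]

lemma contractAlong_succ_succ_cons (k : ℕ) (ns : List ℕ) (a b : Bracket d) (t : Word d) :
    contractAlong ((k + 2) :: ns) (a :: b :: t) = contractAlong ((k + 1) :: ns) (a * b :: t) := by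
  simp [contractAlong, List.splitWrtCompositionAux, blockProd]

/-- The composition obtained by prepending a block of length one. -/
def consOne {n : ℕ} (c : Composition n) : Composition (n + 1) where
  blocks := 1 :: c.blocks
  blocks_pos := by
    intro i hi
    rcases List.mem_cons.1 hi with rfl | h
    · exact one_pos
    · exact c.blocks_pos h
  blocks_sum := by simp [c.blocks_sum, add_comm]

/-- The composition obtained by lengthening the first block by one. -/
def growHead {n : ℕ} (c : Composition (n + 1)) : Composition (n + 2) where
  blocks := (c.blocks.head! + 1) :: c.blocks.tail
  blocks_pos := by
    intro i hi
    rcases List.mem_cons.1 hi with rfl | h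
    · exact Nat.succ_pos _
    · exact c.blocks_pos (List.mem_of_mem_tail h)
  blocks_sum := by
    have hs := c.blocks_sum
    cases h : c.blocks with
    | nil => simp [h] at hs
    | cons k l =>
      simp [h] at hs ⊢
      omega

lemma exists_blocks_eq_succ_cons {n : ℕ} (c : Composition (n + 1)) :
    ∃ k l, c.blocks = (k + 1) :: l := by
  have hs := c.blocks_sum
  cases h : c.blocks with
  | nil => simp [h] at hs
  | cons k l =>
    have hk : 0 < k := c.blocks_pos (h ▸ List.mem_cons_self)
    exact ⟨k - 1, l, by rw [Nat.sub_add_cancel hk]⟩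

lemma bijective_consOne_growHead (n : ℕ) :
    Function.Bijective (Sum.elim consOne growHead :
      Composition (n + 1) ⊕ Composition (n + 1) → Composition (n + 2)) := by
  constructor
  · rintro (c | c) (e | e) h <;> have hb := congrArg Composition.blocks h <;>
      obtain ⟨k, l, hc⟩ := exists_blocks_eq_succ_cons c <;>
      obtain ⟨k', l', he⟩ := exists_blocks_eq_succ_cons e <;>
      simp [consOne, growHead, hc, he] at hb
    · exact congrArg Sum.inl (Composition.ext (by rw [hc, he, hb.1, hb.2]))
    · exact congrArg Sum.inr (Composition.ext (by rw [hc, he, hb.1, hb.2]))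
  · intro c
    obtain ⟨k, l, hc⟩ := exists_blocks_eq_succ_cons c
    have hs := c.blocks_sum
    have hp : ∀ {i}, i ∈ l → 0 < i := fun hi => c.blocks_pos (by simp [hc, hi])
    rw [hc, List.sum_cons] at hs
    cases k with
    | zero =>
      exact ⟨Sum.inl ⟨l, hp, by omega⟩, Composition.ext (by simp [consOne, hc])⟩
    | succ k =>
      refine ⟨Sum.inr ⟨(k + 1) :: l, ?_, by rw [List.sum_cons]; omega⟩,
        Composition.ext (by simp [growHead, hc])⟩
      intro i hi
      rcases List.mem_cons.1 hi with rfl | h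
      · exact Nat.succ_pos _
      · exact hp h

lemma sum_Iword_cons (a : Bracket d) (t : Word d) :
    ∑ c : Composition (t.length + 1), Finsupp.single (Iword c (a :: t)) (1 : K) =
      contractCons K a t := by
  induction t generalizing a with
  | nil =>
    have : Subsingleton (Composition 1) :=
      Fintype.card_le_one_iff_subsingleton.1 (composition_card 1).le
    exact Fintype.sum_subsingleton _ (Composition.ones 1)
  | cons b t ih =>
    rw [List.length_cons, ← (Equiv.ofBijective _ (bijective_consOne_growHead _)).sum_comp,
      Fintype.sum_sum_type, contractCons, ← ih, ← ih, map_sum]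
    congr 1
    · refine Finset.sum_congr rfl fun c _ => ?_
      rw [consL_single]
      exact congrArg (Finsupp.single · 1) (contractAlong_one_cons c.blocks a (b :: t))
    · refine Finset.sum_congr rfl fun c _ => ?_
      obtain ⟨k, l, hc⟩ := exists_blocks_eq_succ_cons c
      refine congrArg (Finsupp.single · 1) ?_
      change contractAlong ((c.blocks.head! + 1) :: c.blocks.tail) _ = contractAlong c.blocks _
      rw [hc]
      exact contractAlong_succ_succ_cons k l a b t

lemma sum_Iword {n : ℕ} (w : Word d) (h : w.length = n) :
    ∑ c : Composition n, Finsupp.single (Iword c w) (1 : K) = contract K w := by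
  subst h
  cases w with
  | nil =>
    have : Subsingleton (Composition 0) :=
      Fintype.card_le_one_iff_subsingleton.1 (composition_card 0).le
    exact Fintype.sum_subsingleton _ (Composition.ones 0)
  | cons a t => exact sum_Iword_cons K a t

lemma alphaW_eq (w : Word d) :
    (alphaW w : TA K d) = (-1 : K) ^ w.length • contract K w.reverse := by
  rw [alphaW, sum_Iword K w.reverse w.length_reverse]

end Contractions

section Telescoping

variable (K : Type*) [Field K] {d : ℕ}

/-- The sum, over all factorizations `s = s₁ s₂`, of the quasi-shuffle products of `p` with the
contractions of `s₂`, preceded by the letter obtained by multiplying `y` and all letters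
of `s₁`. -/
def bracketSum (p : Word d) : Bracket d → Word d → TA K d
  | y, [] => Finsupp.single (y :: p) 1
  | y, x :: s => consL K y (qshLeft K p (contractCons K x s)) + bracketSum p (y * x) s

lemma bracketSum_nil (y : Bracket d) (s : Word d) :
    bracketSum K [] y s = contractCons K y s := by
  induction s generalizing y with
  | nil => rfl
  | cons x s ih => rw [bracketSum, contractCons, ih, qshLeft_nil]

lemma qshLeft_cons_contractCons (p : Word d) (y z : Bracket d) (s : Word d) :
    qshLeft K (y :: p) (contractCons K z s) =
      bracketSum K (y :: p) z s + bracketSum K p y (z :: s) := by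
  induction s generalizing z with
  | nil =>
    simp [contractCons, bracketSum, qshRev_cons_cons]
    abel
  | cons x s ih =>
    simp only [contractCons, bracketSum, map_add, qshLeft_cons_consL, ih, mul_assoc]
    abel

lemma sum_qshLeft_cons (p : Word d) (y : Bracket d) (s : Word d) :
    ∑ i ∈ Finset.range (s.length + 1), qshLeft K ((s.take i).reverse ++ y :: p)
        ((-1 : K) ^ (s.drop i).length • contract K (s.drop i)) =
      (-1 : K) ^ s.length • bracketSum K p y s := by
  induction s generalizing p y with
  | nil => simp [contract, bracketSum]
  | cons x s ih =>
    have h := ih (y :: p) x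
    rw [List.length_cons, Finset.sum_range_succ']
    simp only [List.take_succ_cons, List.drop_succ_cons, List.reverse_cons, List.append_assoc,
      List.singleton_append, h, List.take_zero, List.drop_zero, List.reverse_nil,
      List.nil_append]
    rw [map_smul, contract_cons, qshLeft_cons_contractCons, List.length_cons, pow_succ]
    module

lemma sum_qshLeft_contract (w : Word d) :
    ∑ i ∈ Finset.range (w.length + 1), qshLeft K (w.take i).reverse
        ((-1 : K) ^ (w.drop i).length • contract K (w.drop i)) =
      if w = [] then Finsupp.single ([] : Word d) (1 : K) else 0 := by
  cases w with
  | nil => simp [contract]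
  | cons x s =>
    have h := sum_qshLeft_cons K [] x s
    rw [List.length_cons, Finset.sum_range_succ']
    simp only [List.take_succ_cons, List.drop_succ_cons, List.reverse_cons, h, List.take_zero,
      List.drop_zero, List.reverse_nil]
    simp [contract_cons, qshLeft_nil, bracketSum_nil, pow_succ]

end Telescoping

/-- `α` is an antipode for the quasi-shuffle bialgebra:
`m_⋆(α ⊗ id)δ = ηε = m_⋆(id ⊗ α)δ`, so `(T(𝔄), ⋆, δ, ε, α)` is a Hopf algebra. -/
theorem quasi_shuffle_antipode {K : Type*} [Field K] [CharZero K] {d : ℕ} (w : Word d) :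
    (∑ i ∈ Finset.range (w.length + 1),
        qshL (alphaW (w.take i)) (Finsupp.single (w.drop i) (1 : K)))
      = (if w = [] then Finsupp.single ([] : Word d) (1 : K) else 0) ∧
    (∑ i ∈ Finset.range (w.length + 1),
        qshL (Finsupp.single (w.take i) (1 : K)) (alphaW (w.drop i)))
      = (if w = [] then Finsupp.single ([] : Word d) (1 : K) else 0) := by
  constructor
  · have h := sum_qshLeft_contract K w.reverse
    rw [List.length_reverse, ← Finset.sum_range_reflect] at h
    simp only [List.reverse_eq_nil_iff] at h
    rw [← h]
    refine Finset.sum_congr rfl fun i hi => ?_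
    have hi : i ≤ w.length := Nat.lt_succ_iff.1 (Finset.mem_range.1 hi)
    rw [qshL_single_right, alphaW_eq, List.take_reverse, List.drop_reverse,
      List.reverse_reverse, List.length_reverse,
      show w.length - (w.length + 1 - 1 - i) = i by omega]
  · have h := congrArg (revL K) (sum_qshLeft_contract K w)
    rw [map_sum] at h
    convert h using 1
    · refine Finset.sum_congr rfl fun i _ => ?_
      rw [qshL_single_left, alphaW_eq, ← qshLeft_reverse, List.reverse_reverse, map_smul,
        contract_reverse, map_smul, map_smul]
    · split_ifs <;> simp

end TimeWarp
end
end

section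
/- For every word u ∈ T(𝔄) and all a, b ∈ 𝔄, Hoffman's exponential satisfies Φ_H(u([a][b] − [b][a])) = Φ_H(u[a])[b] − Φ_H(u[b])[a]. -/
noncomputable section

open scoped BigOperators

namespace TimeWarp

variable {K : Type*} [Field K] {d : ℕ}
/-- Hoffman's exponential `Φ_H` on a word:
`Φ_H(w) = Σ_{(i₁,…,i_p) ∈ C(ℓ(w))} (i₁!⋯i_p!)⁻¹ I[w]`. -/
def hoffExpW (w : Word d) : TA K d :=
  ∑ c : Composition w.length,
    ((c.blocks.map fun i => (i.factorial : K)).prod)⁻¹ • Finsupp.single (Iword c w) 1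

/-- Linear extension of Hoffman's exponential to `T(𝔄)`. -/
def hoffExpL (f : TA K d) : TA K d := f.sum fun w c => c • hoffExpW w

theorem splitWrtCompositionAux_append {α : Type*} (l l' : List ℕ) (v w : List α)
    (h : l.sum = v.length) :
    (v ++ w).splitWrtCompositionAux (l ++ l')
      = v.splitWrtCompositionAux l ++ w.splitWrtCompositionAux l' := by
  induction l generalizing v with
  | nil =>
    have hv : v = [] := List.length_eq_zero_iff.mp (by simpa using h.symm)
    subst hv
    simp [List.splitWrtCompositionAux]
  | cons n l ih =>
    simp only [List.sum_cons] at h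
    simp only [List.cons_append, List.splitWrtCompositionAux_cons]
    rw [List.take_append_of_le_length (by omega), List.drop_append_of_le_length (by omega),
      ih _ (by rw [List.length_drop]; omega)]

theorem bracket_mul_comm {d : ℕ} (a b : Bracket d) : a * b = b * a :=
  Subtype.ext (add_comm a.1 b.1)

theorem bracket_mul_right_comm {d : ℕ} (a b c : Bracket d) : a * b * c = a * c * b :=
  Subtype.ext (add_right_comm a.1 b.1 c.1)

theorem blockProd_append_pair_comm {d : ℕ} (x : Word d) (a b : Bracket d) :
    blockProd (x ++ [a, b]) = blockProd (x ++ [b, a]) := by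
  cases x with
  | nil => simp [blockProd, bracket_mul_comm a b]
  | cons y t => simp [blockProd, bracket_mul_right_comm _ a b]

theorem hoffExpW_eq_sum {K : Type*} [Field K] {d n : ℕ} (w : Word d) (h : w.length = n) :
    hoffExpW (K := K) w = ∑ c : Composition n,
      ((c.blocks.map fun i => (i.factorial : K)).prod)⁻¹ • Finsupp.single (Iword c w) 1 := by
  subst h
  rfl

/-- The composition obtained by appending a final block of size `1`. -/
def snocOne {n : ℕ} (c : Composition n) : Composition (n + 1) where
  blocks := c.blocks ++ [1]
  blocks_pos := by
    intro i hi
    rcases List.mem_append.mp hi with h | h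
    · exact c.blocks_pos h
    · simp at h
      omega
  blocks_sum := by simp [c.blocks_sum]

theorem snocOne_injective {n : ℕ} : Function.Injective (snocOne (n := n)) := by
  intro c c' h
  exact Composition.ext (List.append_cancel_right (congrArg Composition.blocks h))

theorem exists_snocOne_or_last {n : ℕ} (c : Composition (n + 1)) :
    (∃ c', snocOne c' = c) ∨ ∃ l k, c.blocks = l ++ [k + 2] := by
  rcases List.eq_nil_or_concat c.blocks with h | ⟨l, k, h⟩
  · have := c.blocks_sum
    simp [h] at this
  · rw [List.concat_eq_append] at h
    have hk : 0 < k := c.blocks_pos (by simp [h])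
    rcases Nat.lt_or_ge k 2 with h2 | h2
    · obtain rfl : k = 1 := by omega
      refine Or.inl ⟨⟨l, fun {i} hi => c.blocks_pos (by simp [h, hi]), ?_⟩, ?_⟩
      · have := c.blocks_sum
        simp [h] at this
        exact this
      · exact Composition.ext h.symm
    · exact Or.inr ⟨l, k - 2, by rw [h]; congr 2; omega⟩

theorem Iword_snocOne {d n : ℕ} (c : Composition n) (w : Word d) (b : Bracket d)
    (h : w.length = n) : Iword (snocOne c) (w ++ [b]) = Iword c w ++ [b] := by
  unfold Iword List.splitWrtComposition snocOne
  rw [splitWrtCompositionAux_append _ _ _ _ (by rw [c.blocks_sum, h]), List.filterMap_append]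
  simp [List.splitWrtCompositionAux, blockProd]

theorem Iword_append_pair_comm {d n : ℕ} (c : Composition n) (u : Word d) (a b : Bracket d)
    (hu : u.length + 2 = n) {l : List ℕ} {k : ℕ} (h : c.blocks = l ++ [k + 2]) :
    Iword c (u ++ [a, b]) = Iword c (u ++ [b, a]) := by
  have hs : l.sum + k = u.length := by
    have := c.blocks_sum
    simp [h] at this
    omega
  have key (p q : Bracket d) : Iword c (u ++ [p, q])
      = ((u.take l.sum).splitWrtCompositionAux l
          ++ [u.drop l.sum ++ [p, q]]).filterMap blockProd := by
    unfold Iword List.splitWrtComposition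
    have hu' : u ++ [p, q] = u.take l.sum ++ (u.drop l.sum ++ [p, q]) := by
      rw [← List.append_assoc, List.take_append_drop]
    rw [h, hu', splitWrtCompositionAux_append _ _ _ _ (by rw [List.length_take]; omega),
      List.splitWrtCompositionAux_cons, List.take_of_length_le (i := k + 2) (by simp; omega)]
    simp [List.splitWrtCompositionAux]
  simp only [key, List.filterMap_append, List.filterMap_cons, blockProd_append_pair_comm _ a b]

/-- The part of Hoffman's exponential coming from compositions with last block of size `1`. -/
theorem sum_snocOne {K : Type*} [Field K] {d n : ℕ} (w : Word d) (b : Bracket d)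
    (h : w.length = n) :
    ∑ c ∈ Finset.univ.map ⟨snocOne (n := n), snocOne_injective⟩,
      ((c.blocks.map fun i => (i.factorial : K)).prod)⁻¹ • Finsupp.single (Iword c (w ++ [b])) 1
      = Finsupp.mapDomain (· ++ [b]) (hoffExpW (K := K) w) := by
  rw [Finset.sum_map, hoffExpW_eq_sum w h, Finsupp.mapDomain_finsetSum]
  refine Finset.sum_congr rfl fun c _ => ?_
  rw [Finsupp.mapDomain_smul, Finsupp.mapDomain_single]
  simp only [Function.Embedding.coeFn_mk]
  rw [Iword_snocOne c w b h]
  simp [snocOne]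

/-- For every word `u` and all `a, b ∈ 𝔄`,
`Φ_H(u([a][b] − [b][a])) = Φ_H(u[a])[b] − Φ_H(u[b])[a]`. -/
theorem hoffman_commutator {K : Type*} [Field K] [CharZero K] {d : ℕ}
    (u : Word d) (a b : Bracket d) :
    hoffExpW (K := K) (u ++ [a, b]) - hoffExpW (u ++ [b, a])
      = Finsupp.mapDomain (· ++ [b]) (hoffExpW (u ++ [a]))
        - Finsupp.mapDomain (· ++ [a]) (hoffExpW (u ++ [b])) := by
  classical
  have split (p q : Bracket d) := (hoffExpW_eq_sum (K := K) (n := u.length + 1 + 1)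
    (u ++ [p, q]) (by simp)).trans (Finset.sum_add_sum_compl
      (Finset.univ.map ⟨snocOne (n := u.length + 1), snocOne_injective⟩) _).symm
  have last (p q : Bracket d) := sum_snocOne (K := K) (n := u.length + 1) (u ++ [p]) q (by simp)
  simp only [List.append_assoc, List.cons_append, List.nil_append] at last
  rw [split a b, split b a, last a b, last b a, add_sub_add_comm, add_eq_left, sub_eq_zero]
  refine Finset.sum_congr rfl fun c hc => ?_
  rcases exists_snocOne_or_last c with ⟨c', rfl⟩ | ⟨l, k, h⟩
  · simp at hc
  · rw [Iword_append_pair_comm c u a b rfl h]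

end TimeWarp
end
end

section
/- (Quasi-shuffle identity.) For every time series x: ℕ → 𝕂^d, all integers 0 ≤ n ≤ m, and all words u, v ∈ T(𝔄), the iterated-sums signature satisfies ⟨u ⋆ v, DS(x)_{n,m}⟩ = ⟨u, DS(x)_{n,m}⟩ · ⟨v, DS(x)_{n,m}⟩; that is, DS(x)_{n,m} is a character of the quasi-shuffle algebra (T(𝔄), ⋆). -/
noncomputable section

open scoped BigOperators

namespace TimeWarp

variable {K : Type*} [Field K] {d : ℕ}
/-- `Δx_j^{[u]}`: the product of the coordinates of the increment `Δx_j = x_j - x_{j-1}`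
indicated by the letters of the bracket `u ∈ 𝔄`. -/
def bracketDelta (x : ℕ → Fin d → K) (j : ℕ) (u : Bracket d) : K :=
  (u.1.map fun i => x j i - x (j - 1) i).prod

/-- The iterated-sums signature `⟨w, DS(x)_{n,m}⟩ = Σ_{n<i₁<⋯<i_k≤m} Δx_{i₁}^{[u₁]}⋯Δx_{i_k}^{[u_k]}`
for the word `w = [u₁]⋯[u_k]`. -/
def DS (x : ℕ → Fin d → K) : ℕ → ℕ → Word d → K
  | _, _, [] => 1
  | n, m, u :: w => ∑ j ∈ Finset.Ioc n m, bracketDelta x j u * DS x j m w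
/-- The counit `ε`, viewed as a scalar-valued functional on words. -/
def epsFun : Word d → K := fun w => if w = [] then 1 else 0

/-- Convolution (dual to deconcatenation) of two scalar-valued functionals on words:
`(c · c')(w) = Σ_{uv = w} c(u) c'(v)`. -/
def convFun (c c' : Word d → K) : Word d → K := fun w =>
  ∑ i ∈ Finset.range (w.length + 1), c (w.take i) * c' (w.drop i)

/-- Pairing of a functional on words with an element of `T(𝔄)` (linear extension). -/
def appF (c : Word d → K) (f : TA K d) : K := f.sum fun w cw => cw * c w

theorem appF_single (c : Word d → K) (w : Word d) : appF c (Finsupp.single w 1) = c w := by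
  simp [appF]

theorem appF_add (c : Word d → K) (f g : TA K d) : appF c (f + g) = appF c f + appF c g :=
  Finsupp.sum_add_index' (by simp) (by simp [add_mul])

theorem appF_mapDomain (c : Word d → K) (φ : Word d → Word d) (f : TA K d) :
    appF c (Finsupp.mapDomain φ f) = appF (fun w => c (φ w)) f :=
  Finsupp.sum_mapDomain_index (by simp) (by simp [add_mul])

theorem appF_add_smul (c c' : Word d → K) (r : K) (f : TA K d) :
    appF (fun w => c w + r * c' w) f = appF c f + r * appF c' f := by
  simp only [appF, Finsupp.sum, Finset.mul_sum, ← Finset.sum_add_distrib]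
  exact Finset.sum_congr rfl fun w _ => by ring

theorem bracketDelta_mul (x : ℕ → Fin d → K) (j : ℕ) (a b : Bracket d) :
    bracketDelta x j (a * b) = bracketDelta x j a * bracketDelta x j b := by
  change ((a.1 + b.1).map _).prod = _
  simp [bracketDelta]

theorem DS_nil (x : ℕ → Fin d → K) (n m : ℕ) : DS x n m [] = 1 := by
  simp [DS]

theorem DS_cons (x : ℕ → Fin d → K) (n m : ℕ) (a : Bracket d) (w : Word d) :
    DS x n m (a :: w) = ∑ j ∈ Finset.Ioc n m, bracketDelta x j a * DS x j m w := by
  simp [DS]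

theorem DS_self_of_ne_nil (x : ℕ → Fin d → K) (n : ℕ) {w : Word d} (hw : w ≠ []) :
    DS x n n w = 0 := by
  cases w with
  | nil => contradiction
  | cons a w => simp [DS_cons]

theorem DS_succ_append_singleton (x : ℕ → Fin d → K) {n m : ℕ} (hnm : n ≤ m) (w : Word d)
    (a : Bracket d) :
    DS x n (m + 1) (w ++ [a]) =
      DS x n m (w ++ [a]) + bracketDelta x (m + 1) a * DS x n m w := by
  induction w generalizing n with
  | nil => simp [DS_cons, DS_nil, Finset.sum_Ioc_succ_top hnm]
  | cons b w ih =>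
    simp only [List.cons_append, DS_cons]
    rw [Finset.sum_Ioc_succ_top hnm, DS_self_of_ne_nil x (m + 1) (by simp), mul_zero, add_zero,
      Finset.mul_sum, ← Finset.sum_add_distrib]
    refine Finset.sum_congr rfl fun j hj => ?_
    rw [ih (Finset.mem_Ioc.mp hj).2]
    ring

theorem appF_qshRev_of_cons_eq_zero {c : Word d → K} (hnil : c [] = 1)
    (hcons : ∀ a w, c (a :: w) = 0) (u v : Word d) :
    appF c (qshRev u v) = c u * c v := by
  cases u with
  | nil => simp [qshRev, appF_single, hnil]
  | cons a u =>
    cases v with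
    | nil => simp [qshRev, appF_single, hnil]
    | cons b v =>
      rw [qshRev]
      simp only [appF_add, appF_mapDomain, hcons]
      simp [appF]

/-- If `c` is a character for the quasi-shuffle product on reversed words, then so is its
extension by one further time step with increments `δ`. -/
theorem appF_qshRev_of_step {c c' : Word d → K} {δ : Bracket d → K}
    (hδ : ∀ a b, δ (a * b) = δ a * δ b) (hnil : c' [] = 1)
    (hstep : ∀ a w, c' (a :: w) = c (a :: w) + δ a * c w)
    (hc : ∀ u v, appF c (qshRev u v) = c u * c v) (u v : Word d) :
    appF c' (qshRev u v) = c' u * c' v := by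
  cases u with
  | nil => simp [qshRev, appF_single, hnil]
  | cons a u =>
    cases v with
    | nil => simp [qshRev, appF_single, hnil]
    | cons b v =>
      have h := hc (a :: u) (b :: v)
      rw [qshRev] at h ⊢
      simp only [appF_add, appF_mapDomain] at h
      simp only [appF_add, appF_mapDomain, hstep, appF_add_smul, hδ, hc]
      linear_combination h

theorem appF_DS_reverse_qshRev (x : ℕ → Fin d → K) {n m : ℕ} (hnm : n ≤ m) (u v : Word d) :
    appF (fun w => DS x n m w.reverse) (qshRev u v) =
      DS x n m u.reverse * DS x n m v.reverse := by
  induction m, hnm using Nat.le_induction generalizing u v with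
  | base =>
    exact appF_qshRev_of_cons_eq_zero (c := fun w => DS x n n w.reverse) (by simp [DS_nil])
      (fun a w => DS_self_of_ne_nil x n (by simp)) u v
  | succ m hnm ih =>
    exact appF_qshRev_of_step (c := fun w => DS x n m w.reverse)
      (c' := fun w => DS x n (m + 1) w.reverse) (bracketDelta_mul x (m + 1))
      (by simp [DS_nil])
      (fun a w => by simpa using DS_succ_append_singleton x hnm w.reverse a) ih u v

/-- Quasi-shuffle identity: the iterated-sums signature `DS(x)_{n,m}` is a character of
the quasi-shuffle algebra: `⟨u ⋆ v, DS(x)_{n,m}⟩ = ⟨u, DS(x)_{n,m}⟩ ⟨v, DS(x)_{n,m}⟩`. -/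
theorem DS_quasi_shuffle_character {K : Type*} [Field K] [CharZero K] {d : ℕ}
    (x : ℕ → Fin d → K) (n m : ℕ) (hnm : n ≤ m) (u v : Word d) :
    appF (DS x n m) (qshW u v) = DS x n m u * DS x n m v := by
  rw [qshW, appF_mapDomain, appF_DS_reverse_qshRev x hnm, List.reverse_reverse,
    List.reverse_reverse]

end TimeWarp
end
end

section
/- (Chen's property.) For every time series x: ℕ → 𝕂^d and all integers n < n' < n'', the iterated-sums signature satisfies DS(x)_{n,n'} · DS(x)_{n',n''} = DS(x)_{n,n''}, where · is the convolution dual to deconcatenation; explicitly, for every word w ∈ T(𝔄), ⟨w, DS(x)_{n,n''}⟩ = Σ_{uv=w} ⟨u, DS(x)_{n,n'}⟩⟨v, DS(x)_{n',n''}⟩, the sum being over all splittings of w into a prefix u and suffix v (including u = e or v = e). -/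
noncomputable section

open scoped BigOperators

namespace TimeWarp

variable {K : Type*} [Field K] {d : ℕ}
/-- The splitting identity at an intermediate time, where the two time intervals may be empty. -/
theorem DS_eq_sum_take_drop {K : Type*} [Field K] {d : ℕ} (x : ℕ → Fin d → K)
    {n n' n'' : ℕ} (h1 : n ≤ n') (h2 : n' ≤ n'') (w : Word d) :
    DS x n n'' w
      = ∑ i ∈ Finset.range (w.length + 1), DS x n n' (w.take i) * DS x n' n'' (w.drop i) := by
  induction w generalizing n with
  | nil => simp [DS]
  | cons u w ih =>
    have hsplit : DS x n n'' (u :: w) =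
        ∑ j ∈ Finset.Ioc n n', bracketDelta x j u * DS x j n'' w + DS x n' n'' (u :: w) := by
      simp only [DS]
      exact (Finset.sum_Ioc_consecutive _ h1 h2).symm
    rw [hsplit, List.length_cons, Finset.sum_range_succ']
    congr 1
    · simp only [List.take_succ_cons, List.drop_succ_cons, DS, Finset.sum_mul]
      rw [Finset.sum_comm]
      refine Finset.sum_congr rfl fun j hj => ?_
      simp only [ih (Finset.mem_Ioc.mp hj).2, Finset.mul_sum, mul_assoc]
    · simp [DS]

/-- Chen's property for the iterated-sums signature:
`DS(x)_{n,n'} · DS(x)_{n',n''} = DS(x)_{n,n''}`, where `·` is the convolution dual to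
deconcatenation (the sum is over all prefix–suffix splittings of `w`). -/
theorem DS_chen {K : Type*} [Field K] [CharZero K] {d : ℕ}
    (x : ℕ → Fin d → K) (n n' n'' : ℕ) (h1 : n < n') (h2 : n' < n'') (w : Word d) :
    DS x n n'' w
      = ∑ i ∈ Finset.range (w.length + 1), DS x n n' (w.take i) * DS x n' n'' (w.drop i) := by
  exact DS_eq_sum_take_drop x h1.le h2.le w

end TimeWarp
end
end

section
/- (Factorisation of the iterated-sums signature.) For every time series x: ℕ → 𝕂^d and every j ≥ 1, the one-step signature satisfies ⟨e, DS(x)_{j−1,j}⟩ = 1, ⟨[u], DS(x)_{j−1,j}⟩ = Δx_j^{[u]} for every single bracket [u] ∈ 𝔄, and ⟨w, DS(x)_{j−1,j}⟩ = 0 for every word w of length ≥ 2; consequently, for all n ≤ m, DS(x)_{n,m} = DS(x)_{n,n+1} · DS(x)_{n+1,n+2} · ⋯ · DS(x)_{m−1,m}, where · is the convolution (c·c')(w) = Σ_{uv=w} c(u)c'(v) over all prefix–suffix splittings of w. -/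
noncomputable section

open scoped BigOperators

namespace TimeWarp

variable {K : Type*} [Field K] {d : ℕ}
theorem DS_self (x : ℕ → Fin d → K) (m : ℕ) (w : Word d) : DS x m m w = epsFun w := by
  cases w <;> simp [DS, epsFun]

theorem DS_succ_cons (x : ℕ → Fin d → K) (n : ℕ) (u : Bracket d) (w : Word d) :
    DS x n (n + 1) (u :: w) = bracketDelta x (n + 1) u * epsFun w := by
  simp [DS, DS_self]

theorem DS_cons_of_lt (x : ℕ → Fin d → K) {n m : ℕ} (h : n < m) (u : Bracket d) (w : Word d) :
    DS x n m (u :: w)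
      = bracketDelta x (n + 1) u * DS x (n + 1) m w + DS x (n + 1) m (u :: w) := by
  have hI : Finset.Ioc n m = insert (n + 1) (Finset.Ioc (n + 1) m) := by
    ext j
    simp only [Finset.mem_Ioc, Finset.mem_insert]
    omega
  simp only [DS]
  rw [hI, Finset.sum_insert (by simp)]

theorem epsFun_convFun (c : Word d → K) : convFun epsFun c = c := by
  funext w
  rw [convFun, Finset.sum_range_succ', Finset.sum_eq_zero]
  · simp [epsFun]
  · intro i hi
    have hw : w ≠ [] := by
      rintro rfl
      simp at hi
    simp [epsFun, hw]

theorem DS_succ_convFun_DS (x : ℕ → Fin d → K) {n m : ℕ} (h : n < m) :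
    convFun (DS x n (n + 1)) (DS x (n + 1) m) = DS x n m := by
  funext w
  cases w with
  | nil => simp [convFun, DS]
  | cons u w =>
    have hε := congrFun (epsFun_convFun (DS x (n + 1) m)) w
    rw [convFun] at hε
    rw [DS_cons_of_lt x h, convFun, List.length_cons, Finset.sum_range_succ', ← hε,
      Finset.mul_sum]
    congr 1
    · refine Finset.sum_congr rfl fun i _ => ?_
      rw [List.take_succ_cons, List.drop_succ_cons, DS_succ_cons, mul_assoc]
    · simp [DS]

theorem foldr_convFun_DS (x : ℕ → Fin d → K) (k n : ℕ) :
    ((List.range k).map fun i => DS x (n + i) (n + i + 1)).foldr convFun epsFun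
      = DS x n (n + k) := by
  induction k generalizing n with
  | zero => exact funext fun w => (DS_self x n w).symm
  | succ k ih =>
    have hshift : (fun i => DS x (n + i) (n + i + 1)) ∘ Nat.succ
        = fun i => DS x (n + 1 + i) (n + 1 + i + 1) := by
      funext i
      simp only [Function.comp_apply, Nat.succ_eq_add_one, Nat.add_right_comm n 1 i, ← add_assoc]
    rw [List.range_succ_eq_map, List.map_cons, List.map_map, hshift, List.foldr_cons, ih,
      add_zero, Nat.add_right_comm n 1 k]
    exact DS_succ_convFun_DS x (by omega)

/-- Factorisation of the iterated-sums signature: the one-step signature `DS(x)_{j−1,j}`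
equals `ε` plus the increments on single brackets (and vanishes on words of length ≥ 2),
and `DS(x)_{n,m}` is the convolution product of the one-step signatures. -/
theorem DS_factorisation {K : Type*} [Field K] [CharZero K] {d : ℕ} (x : ℕ → Fin d → K) :
    (∀ j : ℕ, 1 ≤ j →
        DS x (j - 1) j ([] : Word d) = 1 ∧
        (∀ u : Bracket d, DS x (j - 1) j [u] = bracketDelta x j u) ∧
        (∀ w : Word d, 2 ≤ w.length → DS x (j - 1) j w = 0)) ∧
    (∀ n m : ℕ, n ≤ m → ∀ w : Word d,
        DS x n m w
          = (((List.range (m - n)).map fun k => DS x (n + k) (n + k + 1)).foldr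
              convFun epsFun) w) := by
  refine ⟨fun j hj => ?_, fun n m h w => ?_⟩
  · obtain ⟨n, rfl⟩ := Nat.exists_eq_add_of_le' hj
    rw [Nat.add_sub_cancel]
    refine ⟨by simp [DS], fun u => by simp [DS_succ_cons, epsFun], fun w hw => ?_⟩
    match w, hw with
    | u :: v :: w, _ => simp [DS_succ_cons, epsFun]
  · rw [foldr_convFun_DS, Nat.add_sub_cancel' h]

end TimeWarp
end
end

section
/- For every character c of the quasi-shuffle algebra (a linear functional with c(e) = 1 and c(u ⋆ v) = c(u)c(v)) and every word u ∈ T(𝔄), one has ⟨u, log·(c)⟩ = ⟨𝔢(u), c⟩, where log·(c) = Σ_{i≥1} ((−1)^{i−1}/i)(c − ε)^{·i} is the logarithm with respect to the concatenation convolution (c·c')(w) = Σ_{uv=w} c(u)c'(v), and 𝔢 = Σ_{k≥1} ((−1)^{k−1}/k) J^{∗k} is the adjoint Eulerian idempotent, with J = id − ηε and convolution ψ∗γ = m_⋆(ψ⊗γ)δ on End(T(𝔄)); both series terminate when evaluated on any fixed word. -/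
noncomputable section

open scoped BigOperators

namespace TimeWarp

variable {K : Type*} [Field K] {d : ℕ}
/-- Convolution powers of a scalar-valued functional on words. -/
def convPow (c : Word d → K) : ℕ → Word d → K
  | 0 => epsFun
  | n + 1 => convFun c (convPow c n)

/-- The logarithm `log·(c) = Σ_{i≥1} ((−1)^{i−1}/i) (c − ε)^{·i}` with respect to the
concatenation convolution; the series terminates: on a word `w` only `i ≤ ℓ(w)` contribute. -/
def logFun (c : Word d → K) : Word d → K := fun w =>
  ∑ i ∈ Finset.Icc 1 w.length,
    ((-1 : K) ^ (i - 1) / (i : K)) * convPow (fun u => c u - epsFun u) i w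

/-- Convolution product on linear endomorphisms of `T(𝔄)` (given on the basis of words):
`(ψ ∗ γ)(w) = m_⋆ (ψ ⊗ γ) δ(w)`. -/
def endConv (ψ γ : Word d → TA K d) : Word d → TA K d := fun w =>
  ∑ i ∈ Finset.range (w.length + 1), qshL (ψ (w.take i)) (γ (w.drop i))

/-- The unit `ηε` of the convolution algebra of endomorphisms. -/
def unitEps : Word d → TA K d := fun w => if w = [] then Finsupp.single [] 1 else 0

/-- The projection `J = id − ηε` onto the augmentation ideal. -/
def Jmap : Word d → TA K d := fun w => if w = [] then 0 else Finsupp.single w 1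

/-- Convolution powers `J^{∗k}` of `J` (with `J^{∗0} = ηε`). -/
def Jpow : ℕ → Word d → TA K d
  | 0 => unitEps
  | n + 1 => endConv Jmap (Jpow n)

/-- The adjoint Eulerian idempotent `𝔢 = Σ_{k≥1} ((−1)^{k−1}/k) J^{∗k}`;
the series terminates: on a word `w` only `k ≤ ℓ(w)` contribute. -/
def eulerian (w : Word d) : TA K d :=
  ∑ k ∈ Finset.Icc 1 w.length, ((-1 : K) ^ (k - 1) / (k : K)) • Jpow k w

theorem appF_eq_linearCombination (c : Word d → K) (f : TA K d) :
    appF c f = Finsupp.linearCombination K c f := rfl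

theorem appF_sum {ι : Type*} (c : Word d → K) (s : Finset ι) (f : ι → TA K d) :
    appF c (∑ i ∈ s, f i) = ∑ i ∈ s, appF c (f i) := by
  simp only [appF_eq_linearCombination, map_sum]

theorem appF_smul (c : Word d → K) (a : K) (f : TA K d) : appF c (a • f) = a * appF c f := by
  simp only [appF_eq_linearCombination, map_smul, smul_eq_mul]

/-- A functional multiplicative on words is multiplicative on all of `T(𝔄)`. -/
theorem appF_qshL {c : Word d → K} (hcmul : ∀ u v : Word d, appF c (qshW u v) = c u * c v)
    (f g : TA K d) : appF c (qshL f g) = appF c f * appF c g := by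
  unfold qshL Finsupp.sum
  simp only [appF_sum, appF_smul, hcmul]
  simp only [appF, Finsupp.sum, Finset.sum_mul_sum]
  exact Finset.sum_congr rfl fun u _ => Finset.sum_congr rfl fun v _ => by ring

/-- Composition with a character turns `∗` into the concatenation convolution. -/
theorem appF_endConv {c : Word d → K} (hcmul : ∀ u v : Word d, appF c (qshW u v) = c u * c v)
    (ψ γ : Word d → TA K d) (w : Word d) :
    appF c (endConv ψ γ w) = convFun (fun u => appF c (ψ u)) (fun u => appF c (γ u)) w := by
  simp only [endConv, convFun, appF_sum, appF_qshL hcmul]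

theorem appF_unitEps {c : Word d → K} (hc1 : c [] = 1) (w : Word d) :
    appF c (unitEps w) = epsFun w := by
  by_cases hw : w = [] <;> simp [appF, unitEps, epsFun, hw, hc1]

theorem appF_Jmap {c : Word d → K} (hc1 : c [] = 1) (w : Word d) :
    appF c (Jmap w) = c w - epsFun w := by
  by_cases hw : w = [] <;> simp [appF, Jmap, epsFun, hw, hc1]

theorem appF_Jpow {c : Word d → K} (hc1 : c [] = 1)
    (hcmul : ∀ u v : Word d, appF c (qshW u v) = c u * c v) (k : ℕ) (w : Word d) :
    appF c (Jpow k w) = convPow (fun u => c u - epsFun u) k w := by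
  induction k generalizing w with
  | zero => exact appF_unitEps hc1 w
  | succ k ih => simp only [Jpow, convPow, appF_endConv hcmul, appF_Jmap hc1, ih]

/-- For every character `c` of the quasi-shuffle algebra and every word `u`,
`⟨u, log·(c)⟩ = ⟨𝔢(u), c⟩`. -/
theorem log_eq_eulerian_adjoint {K : Type*} [Field K] [CharZero K] {d : ℕ}
    (c : Word d → K) (hc1 : c [] = 1)
    (hcmul : ∀ u v : Word d, appF c (qshW u v) = c u * c v) (u : Word d) :
    logFun c u = appF c (eulerian u) := by
  simp only [logFun, eulerian, appF_sum, appF_smul, appF_Jpow hc1 hcmul]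

end TimeWarp
end
end

section
/- For every real-valued time series x ∈ (ℝ^d)^ℕ that is eventually constant, the coefficient of the word [1²] ∈ 𝔄 (the bracket of the letter 1 squared) in the logarithm of the iterated-sums signature equals ⟨[1²], log·(DS(x))⟩ = Σ_j (Δx_j^{(1)})² ≥ 0. In particular, the logarithms of iterated-sums signatures do not exhaust the Lie algebra of infinitesimal characters of the quasi-shuffle Hopf algebra (no analogue of Chow's theorem holds). -/
noncomputable section

open scoped BigOperators

namespace TimeWarp

variable {K : Type*} [Field K] {d : ℕ}
/-- The binomial coefficient `X choose k` as a real polynomial in `X`. -/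
def binomPoly : ℕ → Polynomial ℝ
  | 0 => 1
  | k + 1 => Polynomial.C ((k + 1 : ℝ)⁻¹) * (Polynomial.X - Polynomial.C (k : ℝ)) * binomPoly k

theorem binomPoly_eval_natCast (N k : ℕ) :
    (binomPoly k).eval (N : ℝ) = (N.choose k : ℝ) := by
  induction k with
  | zero => simp [binomPoly]
  | succ k ih =>
    have hk : (k + 1 : ℝ) ≠ 0 := by positivity
    have h : (N.choose (k + 1) : ℝ) * (k + 1) = N.choose k * ((N : ℝ) - k) := by
      rcases le_or_gt k N with hkN | hkN
      · rw [← Nat.cast_sub hkN]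
        exact_mod_cast Nat.choose_succ_right_eq N k
      · simp [Nat.choose_eq_zero_of_lt hkN,
          Nat.choose_eq_zero_of_lt (hkN.trans (Nat.lt_succ_self k))]
    simp only [binomPoly, Polynomial.eval_mul, Polynomial.eval_sub, Polynomial.eval_C,
      Polynomial.eval_X, ih]
    field_simp
    linarith

theorem binomPoly_eval_zero {k : ℕ} (hk : k ≠ 0) : (binomPoly k).eval 0 = 0 := by
  have h := binomPoly_eval_natCast 0 k
  rwa [Nat.cast_zero, Nat.choose_eq_zero_of_lt (Nat.pos_of_ne_zero hk), Nat.cast_zero] at h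

theorem binomPoly_derivative_eval_zero (k : ℕ) :
    (Polynomial.derivative (binomPoly k)).eval 0 = -((-1) ^ k / (k : ℝ)) := by
  induction k with
  | zero => simp [binomPoly]
  | succ k ih =>
    have hk : (k + 1 : ℝ) ≠ 0 := by positivity
    rcases eq_or_ne k 0 with rfl | hk0
    · simp [binomPoly]
    · have hk0' : (k : ℝ) ≠ 0 := by exact_mod_cast hk0
      simp only [binomPoly, Polynomial.derivative_mul, Polynomial.eval_add, Polynomial.eval_mul,
        binomPoly_eval_zero hk0, ih, Polynomial.eval_sub, Polynomial.eval_X, Polynomial.eval_C]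
      push_cast
      field_simp
      ring

/-- The linear functional on `T(𝔄)` sending a word of length `k` to `N choose k`. -/
def chooseFunctional (d N : ℕ) : TA ℝ d →ₗ[ℝ] ℝ :=
  Finsupp.linearCombination ℝ fun w => (N.choose w.length : ℝ)

theorem chooseFunctional_zero_mapDomain_cons (a : Bracket d) (f : TA ℝ d) :
    chooseFunctional d 0 (Finsupp.mapDomain (a :: ·) f) = 0 := by
  rw [chooseFunctional, Finsupp.linearCombination_mapDomain]
  simp [Finsupp.linearCombination_apply]

theorem chooseFunctional_succ_mapDomain_cons (N : ℕ) (a : Bracket d) (f : TA ℝ d) :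
    chooseFunctional d (N + 1) (Finsupp.mapDomain (a :: ·) f) =
      chooseFunctional d N f + chooseFunctional d N (Finsupp.mapDomain (a :: ·) f) := by
  rw [chooseFunctional, chooseFunctional, Finsupp.linearCombination_mapDomain,
    Finsupp.linearCombination_mapDomain]
  simp only [Function.comp_def, Finsupp.linearCombination_apply, List.length_cons, Nat.choose_succ_succ, Nat.cast_add,
    smul_add, Finsupp.sum_add]

theorem chooseFunctional_qshRev (N : ℕ) (u v : Word d) :
    chooseFunctional d N (qshRev u v) = N.choose u.length * N.choose v.length := by
  induction N generalizing u v with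
  | zero =>
    rcases u with _ | ⟨a, u⟩
    · simp [qshRev, chooseFunctional]
    · rcases v with _ | ⟨b, v⟩
      · simp [qshRev, chooseFunctional]
      · simp [qshRev, chooseFunctional_zero_mapDomain_cons]
  | succ N ih =>
    rcases u with _ | ⟨a, u⟩
    · simp [qshRev, chooseFunctional]
    · rcases v with _ | ⟨b, v⟩
      · simp [qshRev, chooseFunctional]
      · have h := ih (a :: u) (b :: v)
        have h₁ := ih u (b :: v)
        have h₂ := ih (a :: u) v
        have h₃ := ih u v
        simp only [qshRev, map_add, chooseFunctional_succ_mapDomain_cons] at h ⊢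
        simp only [List.length_cons, Nat.choose_succ_succ, Nat.cast_add] at h h₁ h₂ h₃ ⊢
        linarith

theorem linearCombination_binomPoly_qshW (u v : Word d) :
    Finsupp.linearCombination ℝ (fun w : Word d => binomPoly w.length) (qshW u v) =
      binomPoly u.length * binomPoly v.length := by
  refine Polynomial.eq_of_infinite_eval_eq _ _
    ((Set.infinite_range_of_injective (Nat.cast_injective (R := ℝ))).mono ?_)
  rintro _ ⟨N, rfl⟩
  have h := chooseFunctional_qshRev N u.reverse v.reverse
  simp only [chooseFunctional, List.length_reverse] at h
  simp only [Set.mem_ofPred_eq, Polynomial.eval_mul, binomPoly_eval_natCast, ← h, qshW,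
    Finsupp.linearCombination_mapDomain, Function.comp_def, List.length_reverse]
  simp [Finsupp.linearCombination_apply, Finsupp.sum, Polynomial.eval_finsetSum,
    binomPoly_eval_natCast]

/-- The functional `w ↦ (-1) ^ ℓ(w) / ℓ(w)`, minus the logarithm of the signature of a single
unit step, vanishes on quasi-shuffles of nonempty words. -/
theorem appF_neg_one_pow_div_length_qshW {u v : Word d} (hu : u ≠ []) (hv : v ≠ []) :
    appF (fun w : Word d => (-1 : ℝ) ^ w.length / (w.length : ℝ)) (qshW u v) = 0 := by
  have h := congrArg (fun p => (Polynomial.derivative p).eval 0)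
    (linearCombination_binomPoly_qshW u v)
  simp only [Polynomial.derivative_mul, Polynomial.eval_add, Polynomial.eval_mul,
    binomPoly_eval_zero (mt List.length_eq_zero_iff.mp hu),
    binomPoly_eval_zero (mt List.length_eq_zero_iff.mp hv), mul_zero, zero_mul,
    Finsupp.linearCombination_apply, Finsupp.sum, Polynomial.derivative_sum,
    Polynomial.eval_finsetSum, Polynomial.derivative_smul, Polynomial.eval_smul,
    binomPoly_derivative_eval_zero, smul_eq_mul, mul_neg, Finset.sum_neg_distrib,
    add_zero, neg_zero, neg_eq_zero] at h
  exact h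

theorem logFun_singleton (c : Word d → ℝ) (u : Bracket d) :
    logFun c [u] = c [u] := by
  simp [logFun, convPow, convFun, epsFun, Finset.sum_range_succ]

theorem logFun_DS_square (x : ℕ → Fin d → ℝ) (N : ℕ) (i : Fin d)
    (h : ({i, i} : Multiset (Fin d)) ≠ 0) :
    logFun (DS x 0 N) [(⟨{i, i}, h⟩ : Bracket d)] =
      ∑ j ∈ Finset.Icc 1 N, (x j i - x (j - 1) i) ^ 2 := by
  rw [logFun_singleton]
  simp only [DS, mul_one]
  refine Finset.sum_congr rfl fun j _ => ?_
  simp [bracketDelta, pow_two]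

/-- The coefficient of the bracket `[1²]` in the logarithm of the iterated-sums signature is
`Σ_j (Δx_j^{(1)})² ≥ 0`; consequently the logarithms of iterated-sums signatures do not
exhaust the Lie algebra of infinitesimal characters of the quasi-shuffle Hopf algebra
(no analogue of Chow's theorem). -/
theorem log_DS_square_nonneg {d : ℕ} (hd : 0 < d) :
    (∀ (x : ℕ → Fin d → ℝ) (N : ℕ), (∀ n, N ≤ n → x n = x N) →
      logFun (DS x 0 N) [(⟨{⟨0, hd⟩, ⟨0, hd⟩}, by simp⟩ : Bracket d)]
          = ∑ j ∈ Finset.Icc 1 N, (x j ⟨0, hd⟩ - x (j - 1) ⟨0, hd⟩) ^ 2 ∧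
      0 ≤ logFun (DS x 0 N) [(⟨{⟨0, hd⟩, ⟨0, hd⟩}, by simp⟩ : Bracket d)]) ∧
    ∃ g : Word d → ℝ, g [] = 0 ∧
      (∀ u v : Word d, u ≠ [] → v ≠ [] → appF g (qshW u v) = 0) ∧
      ∀ (x : ℕ → Fin d → ℝ) (N : ℕ), (∀ n, N ≤ n → x n = x N) → logFun (DS x 0 N) ≠ g := by
  refine ⟨fun x N _ => ?_, fun w => (-1) ^ w.length / (w.length : ℝ), by simp,
    fun u v hu hv => appF_neg_one_pow_div_length_qshW hu hv, fun x N _ hg => ?_⟩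
  · rw [logFun_DS_square]
    exact ⟨rfl, Finset.sum_nonneg fun j _ => sq_nonneg _⟩
  · have h := congrFun hg [(⟨{⟨0, hd⟩, ⟨0, hd⟩}, by simp⟩ : Bracket d)]
    rw [logFun_DS_square] at h
    have h₀ : 0 ≤ ∑ j ∈ Finset.Icc 1 N, (x j ⟨0, hd⟩ - x (j - 1) ⟨0, hd⟩) ^ 2 :=
      Finset.sum_nonneg fun j _ => sq_nonneg _
    rw [h] at h₀
    norm_num at h₀

end TimeWarp
end
end

section
/- (Spanning property of iterated-sums signatures.) For every n ≥ 1, the restrictions of the iterated-sums signatures to words of weight at most n span the full dual space: span_𝕂 { π_{≤n} DS(x) : x ∈ (𝕂^d)^ℕ eventually constant } = π_{≤n} T(𝔄)*. Equivalently, if a finite linear combination Σ_w c_w ⟨w, DS(x)⟩ over words w of weight at most n vanishes for every eventually constant time series x, then all coefficients c_w are zero. -/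
noncomputable section

open scoped BigOperators

namespace TimeWarp

variable {K : Type*} [Field K] {d : ℕ}
/-- The quasisymmetric evaluation of a word on a finite list of increments. -/
def quasiEval : List (Fin d → K) → Word d → K
  | _, [] => 1
  | [], _ :: _ => 0
  | v :: a, u :: w => (u.1.map v).prod * quasiEval a w + quasiEval a (u :: w)

/-- The time series starting at zero with the given list of increments. -/
def ofIncrements (a : List (Fin d → K)) (k : ℕ) : Fin d → K := (a.take k).sum

theorem DS_cons_of_le (x : ℕ → Fin d → K) {n m : ℕ} (h : m ≤ n) (u : Bracket d) (w : Word d) :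
    DS x n m (u :: w) = 0 := by
  simp [DS, Finset.Ioc_eq_empty_of_le h]

theorem bracketDelta_ofIncrements (a : List (Fin d → K)) {n : ℕ} (h : n < a.length)
    (u : Bracket d) :
    bracketDelta (ofIncrements a) (n + 1) u = (u.1.map a[n]).prod := by
  unfold bracketDelta ofIncrements
  congr 2
  funext i
  simp [List.sum_take_succ a n h]

theorem DS_ofIncrements (a : List (Fin d → K)) (n : ℕ) (w : Word d) :
    DS (ofIncrements a) n a.length w = quasiEval (a.drop n) w := by
  cases w with
  | nil => simp [DS_nil, quasiEval]
  | cons u w =>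
    by_cases h : n < a.length
    · rw [DS_cons_of_lt _ h, bracketDelta_ofIncrements a h, DS_ofIncrements a (n + 1) w,
        DS_ofIncrements a (n + 1) (u :: w), List.drop_eq_getElem_cons h, quasiEval]
    · rw [DS_cons_of_le _ (not_lt.mp h), List.drop_eq_nil_of_le (not_lt.mp h), quasiEval]
termination_by (a.length - n)

theorem eval_monomial_toFinsupp (v : Fin d → K) (m : Multiset (Fin d)) (k : K) :
    MvPolynomial.eval v (MvPolynomial.monomial (Multiset.toFinsupp m) k) =
      k * (m.map v).prod := by
  rw [MvPolynomial.eval_monomial, Finset.prod_multiset_map_count]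
  simp [Finsupp.prod]

/-- The part of a word polynomial that records the dependence of `quasiEval` on a newly
prepended increment, when the remaining increments are `a`. -/
def headTerm (a : List (Fin d → K)) (k : K) : Word d → MvPolynomial (Fin d) K
  | [] => 0
  | u :: w => MvPolynomial.monomial (Multiset.toFinsupp u.1) (k * quasiEval a w)

theorem eval_headTerm (a : List (Fin d → K)) (k : K) (v : Fin d → K) (w : Word d) :
    MvPolynomial.eval v (headTerm a k w) =
      k * quasiEval (v :: a) w - k * quasiEval a w := by
  cases w with
  | nil => simp [headTerm, quasiEval]
  | cons u w =>
    rw [headTerm, eval_monomial_toFinsupp, quasiEval]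
    ring

theorem coeff_headTerm_cons_self (a : List (Fin d → K)) (k : K) (u : Bracket d) (w : Word d) :
    MvPolynomial.coeff (Multiset.toFinsupp u.1) (headTerm a k (u :: w)) =
      k * quasiEval a w := by
  simp [headTerm]

theorem coeff_headTerm_of_notMem_range (a : List (Fin d → K)) (k : K) (u : Bracket d)
    (w : Word d) (h : w ∉ Set.range (List.cons u)) :
    MvPolynomial.coeff (Multiset.toFinsupp u.1) (headTerm a k w) = 0 := by
  cases w with
  | nil => simp [headTerm]
  | cons u' w =>
    rw [headTerm, MvPolynomial.coeff_monomial, if_neg]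
    intro hu
    exact h ⟨w, by rw [Subtype.ext (Multiset.toFinsupp.injective hu)]⟩

theorem apply_eq_zero_of_sum_quasiEval [CharZero K] (w : Word d) (c : Word d →₀ K)
    (hc : ∀ a : List (Fin d → K), (c.sum fun w k => k * quasiEval a w) = 0) : c w = 0 := by
  induction w generalizing c with
  | nil =>
    have h := hc []
    rw [Finsupp.sum, Finset.sum_eq_single []] at h
    · simpa [quasiEval] using h
    · intro w _ hw
      cases w with
      | nil => exact absurd rfl hw
      | cons u w => simp [quasiEval]
    · intro h
      simp [Finsupp.notMem_support_iff.mp h]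
  | cons u w ih =>
    have hinj : Function.Injective (List.cons u : Word d → Word d) := List.cons_injective
    refine ih (c.comapDomain (List.cons u) hinj.injOn) fun a => ?_
    have hp : ∑ w ∈ c.support, headTerm a (c w) w = 0 := by
      refine MvPolynomial.funext fun v => ?_
      have h1 := hc (v :: a)
      have h2 := hc a
      rw [Finsupp.sum] at h1 h2
      simp only [map_sum, eval_headTerm, Finset.sum_sub_distrib, h1, h2, sub_zero, map_zero]
    have hcoeff := congrArg (MvPolynomial.coeff (Multiset.toFinsupp u.1)) hp
    rw [MvPolynomial.coeff_sum, MvPolynomial.coeff_zero,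
      ← Finset.sum_preimage (List.cons u) c.support hinj.injOn _
        fun w _ hw => coeff_headTerm_of_notMem_range a (c w) u w hw] at hcoeff
    simp only [coeff_headTerm_cons_self] at hcoeff
    exact hcoeff

/-- Spanning property of iterated-sums signatures: if a finite linear combination
`Σ_w c_w ⟨w, DS(x)⟩` over words of weight at most `n` vanishes for every eventually
constant time series `x`, then all coefficients vanish; equivalently, the restrictions
`π_{≤n} DS(x)` span the full dual space `π_{≤n} T(𝔄)*`. -/
theorem DS_spanning {K : Type*} [Field K] [CharZero K] {d : ℕ} (n : ℕ) (hn : 1 ≤ n)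
    (c : Word d →₀ K) (hwt : ∀ w ∈ c.support, wordWeight w ≤ n)
    (hvanish : ∀ (x : ℕ → Fin d → K) (N : ℕ), (∀ k, N ≤ k → x k = x N) →
      (c.sum fun w cw => cw * DS x 0 N w) = 0) :
    c = 0 := by
  ext w
  refine apply_eq_zero_of_sum_quasiEval w c fun a => ?_
  have h := hvanish (ofIncrements a) a.length fun k hk => by
    simp [ofIncrements, List.take_of_length_le hk]
  simpa only [DS_ofIncrements, List.drop_zero] using h

end TimeWarp
end
end
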